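/- There exists a set A ⊆ ℕ and constants C, c > 0 such that for every n ∈ ℕ, the number σ_A(n) of ordered pairs (a, a') ∈ A² with a + a' = n satisfies 1 ≤ σ_A(n) ≤ C · n^{c/log log n} (with the convention that the upper bound reads C for n ≤ 15). -/

import Mathlib

lemma isSquare_mul_of_not_isSquare {p : ℕ} [Fact p.Prime] {x y : ZMod p} (hx : ¬ IsSquare x) (hy : ¬ IsSquare y) :
    IsSquare (x * y) := by
  have hx0 : x ≠ 0 := by rintro rfl; exact hx (IsSquare.zero)
  have hy0 : y ≠ 0 := by rintro rfl; exact hy (IsSquare.zero)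
  rw [← quadraticChar_neg_one_iff_not_isSquare] at hx hy
  rw [← quadraticChar_one_iff_isSquare (mul_ne_zero hx0 hy0), map_mul, hx, hy]
  norm_num

lemma natCast_ne_zero_of_lt {p k : ℕ} (hk : 0 < k) (hkp : k < p) : (k : ZMod p) ≠ 0 := by
  rw [Ne, ZMod.natCast_eq_zero_iff]
  exact Nat.not_dvd_of_pos_of_lt hk hkp

lemma exists_one_sub_sq_not_isSquare {p : ℕ} [Fact p.Prime] (hp : 7 ≤ p) :
    ∃ s : ZMod p, ¬ IsSquare (1 - s ^ 2) ∧ s ^ 2 ≠ 4 := by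
  have h2 : (2 : ZMod p) ≠ 0 := mod_cast natCast_ne_zero_of_lt (k := 2) (by omega) (by omega)
  have h3 : (3 : ZMod p) ≠ 0 := mod_cast natCast_ne_zero_of_lt (k := 3) (by omega) (by omega)
  have h5 : (5 : ZMod p) ≠ 0 := mod_cast natCast_ne_zero_of_lt (k := 5) (by omega) (by omega)
  by_contra! h
  have h' : ∀ s : ZMod p, s ^ 2 ≠ 4 → IsSquare (1 - s ^ 2) := fun s hs => by
    by_contra h0
    exact hs (h s h0)
  by_cases h1 : IsSquare (-1 : ZMod p)
  · have step : ∀ y : ZMod p, IsSquare y → y ≠ -4 → IsSquare (y + 1) := by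
      rintro y ⟨t, rfl⟩ hy
      obtain ⟨i, hi⟩ := h1
      have e : (i * t) ^ 2 = -(t * t) := by linear_combination -(t * t) * hi
      have := h' (i * t) (by rw [e]; intro h4; exact hy (by linear_combination -h4))
      rwa [e, sub_neg_eq_add, add_comm] at this
    have s2 : IsSquare (2 : ZMod p) := by
      have := step 1 IsSquare.one (fun h => h5 (by linear_combination h))
      rwa [one_add_one_eq_two] at this
    have s3 : IsSquare (3 : ZMod p) := by
      have := step 2 s2 (fun h => mul_ne_zero h2 h3 (by linear_combination h))
      rwa [two_add_one_eq_three] at this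
    have all : ∀ k : ℕ, IsSquare (k : ZMod p) := by
      intro k
      induction k with
      | zero => simp
      | succ k ih =>
        push_cast
        by_cases hk : (k : ZMod p) = -4
        · have := h1.mul s3
          rwa [hk, show (-4 + 1 : ZMod p) = -1 * 3 by ring]
        · exact step _ ih hk
    obtain ⟨x, hx⟩ := FiniteField.exists_nonsquare (F := ZMod p) (by rw [ZMod.ringChar_zmod_n]; omega)
    exact hx (by simpa using all x.val)
  · have step : ∀ t : ZMod p, t ≠ 0 → t ^ 2 ≠ 3 → ¬ IsSquare (1 + t ^ 2) := by
      rintro t ht ht3 ⟨w, hw⟩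
      obtain ⟨r, hr⟩ := h' w (fun h4 => ht3 (by linear_combination hw + h4))
      have : -1 = (r / t) * (r / t) := by
        field_simp
        linear_combination hr - hw
      exact h1 ⟨_, this⟩
    have n2 := step 1 one_ne_zero (fun h => h2 (by linear_combination -h))
    have n5 := step 2 h2 (fun h => one_ne_zero (α := ZMod p) (by linear_combination h))
    have n10 := step 3 h3 (fun h => mul_ne_zero h2 h3 (by linear_combination h))
    apply n10
    convert isSquare_mul_of_not_isSquare n2 n5 using 1
    ring

/-- A set of coefficients `g` such that the parabolas `y = g x²` form a thin basis of `(ZMod p)²`. -/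
lemma exists_parabolas {p : ℕ} [Fact p.Prime] (hp : 7 ≤ p) :
    ∃ S : Finset (ZMod p), S.card ≤ 3 ∧ (∀ g ∈ S, ∀ h ∈ S, g + h ≠ 0) ∧
      ∀ u v : ZMod p, ∃ g ∈ S, ∃ h ∈ S, ∃ x, g * x ^ 2 + h * (u - x) ^ 2 = v := by
  obtain ⟨s, hs, hs4⟩ := exists_one_sub_sq_not_isSquare hp
  have h2 : (2 : ZMod p) ≠ 0 := mod_cast natCast_ne_zero_of_lt (k := 2) (by omega) (by omega)
  have hc : 1 - s ^ 2 ≠ 0 := fun h => hs (h ▸ IsSquare.zero)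
  have ha : 1 + s ≠ 0 := fun h => hc (by linear_combination (1 - s) * h)
  have hb : 1 - s ≠ 0 := fun h => hc (by linear_combination (1 + s) * h)
  have ha2 : 2 - s ≠ 0 := fun h => hs4 (by linear_combination (-2 - s) * h)
  have hb2 : 2 + s ≠ 0 := fun h => hs4 (by linear_combination (s - 2) * h)
  refine ⟨{1 - s ^ 2, 1 + s, 1 - s}, Finset.card_le_three, ?_, ?_⟩
  · have e1 : 1 - s ^ 2 + (1 - s ^ 2) ≠ 0 := fun h => mul_ne_zero h2 hc (by linear_combination h)
    have e2 : 1 - s ^ 2 + (1 + s) ≠ 0 := fun h => mul_ne_zero ha ha2 (by linear_combination h)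
    have e3 : 1 - s ^ 2 + (1 - s) ≠ 0 := fun h => mul_ne_zero hb hb2 (by linear_combination h)
    have e4 : 1 + s + (1 + s) ≠ 0 := fun h => mul_ne_zero h2 ha (by linear_combination h)
    have e5 : 1 + s + (1 - s) ≠ 0 := fun h => h2 (by linear_combination h)
    have e6 : 1 - s + (1 - s) ≠ 0 := fun h => mul_ne_zero h2 hb (by linear_combination h)
    intro g hg h hh
    simp only [Finset.mem_insert, Finset.mem_singleton] at hg hh
    rcases hg with rfl | rfl | rfl <;> rcases hh with rfl | rfl | rfl <;>
      first | assumption | (rw [add_comm]; assumption)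
  · intro u v
    by_cases hw : IsSquare (2 * v - (1 - s ^ 2) * u ^ 2)
    · obtain ⟨r, hr⟩ := hw
      refine ⟨1 + s, by simp, 1 - s, by simp, ((1 - s) * u + r) / 2, ?_⟩
      field_simp
      linear_combination -2 * hr
    · obtain ⟨r, hr⟩ := isSquare_mul_of_not_isSquare hs hw
      refine ⟨1 - s ^ 2, by simp, 1 - s ^ 2, by simp,
        ((1 - s ^ 2) * u + r) / (2 * (1 - s ^ 2)), ?_⟩
      field_simp
      linear_combination -2 * hr

lemma card_quadratic_roots_le {F : Type*} [Field F] [Fintype F] [DecidableEq F] {g h : F}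
    (hgh : g + h ≠ 0) (u v : F) :
    (Finset.univ.filter fun x : F => g * x ^ 2 + h * (u - x) ^ 2 = v).card ≤ 2 := by
  rcases (Finset.univ.filter fun x : F => g * x ^ 2 + h * (u - x) ^ 2 = v).eq_empty_or_nonempty
    with he | ⟨y, hy⟩
  · simp [he]
  · refine (Finset.card_le_card (t := {y, 2 * h * u / (g + h) - y}) ?_).trans Finset.card_le_two
    intro x hx
    simp only [Finset.mem_filter, Finset.mem_univ, true_and, Finset.mem_insert,
      Finset.mem_singleton] at hx hy ⊢
    refine or_iff_not_imp_left.2 fun hxy => ?_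
    have : (x - y) * ((g + h) * (x + y) - 2 * h * u) = 0 := by linear_combination hx - hy
    rcases mul_eq_zero.1 this with h0 | h0
    · exact absurd (sub_eq_zero.1 h0) hxy
    · field_simp
      linear_combination h0

/-- `B ⊆ {0, …, m - 1}` represents every residue modulo `m` as a sum of two of its elements,
in at least one and at most `R` ways. -/
def IsThinBasisMod (m : ℕ) (B : Finset ℕ) (R : ℕ) : Prop :=
  B ⊆ Finset.range m ∧ ∀ n : ℤ,
    (∃ a ∈ B, ∃ b ∈ B, (m : ℤ) ∣ n - a - b) ∧
    ((B ×ˢ B).filter fun q : ℕ × ℕ => (m : ℤ) ∣ n - q.1 - q.2).card ≤ R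

lemma sq_dvd_sub_iff {p x x' : ℕ} (hx : x < p) (hx' : x' < p) (y y' n : ℤ) :
    ((p ^ 2 : ℕ) : ℤ) ∣ n - (x + p * y) - (x' + p * y') ↔
      ∃ ε : ℤ, (ε = 0 ∨ ε = 1) ∧ (x + x' : ℤ) = n % p + ε * p ∧ (p : ℤ) ∣ n / p - y - y' - ε := by
  have hp : (0 : ℤ) < p := by omega
  have hn := Int.emod_add_mul_ediv n p
  have h0 := Int.emod_nonneg n hp.ne'
  have h1 := Int.emod_lt_of_pos n hp
  push_cast
  constructor
  · rintro ⟨k, hk⟩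
    have hε : (x + x' : ℤ) = n % p + (n / p - y - y' - p * k) * p := by
      linear_combination -hk - hn
    have hε0 : 0 ≤ n / p - y - y' - p * k := by
      by_contra! hlt
      nlinarith
    have hε1 : n / p - y - y' - p * k ≤ 1 := by
      by_contra! hlt
      nlinarith
    exact ⟨_, by omega, hε, k, by ring⟩
  · rintro ⟨ε, -, hε, k, hk⟩
    exact ⟨k, by linear_combination -hn - hε + p * hk⟩

lemma exists_isThinBasisMod_sq {p : ℕ} (hp : p.Prime) (hp7 : 7 ≤ p) :
    ∃ B, IsThinBasisMod (p ^ 2) B 432 := by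
  classical
  have := Fact.mk hp
  obtain ⟨S, hS3, hS, hcover⟩ := exists_parabolas hp7
  let Δ : Finset (ZMod p) := {0, 1}
  let B := (Finset.range (p ^ 2)).filter fun z =>
    ∃ g ∈ S, ∃ δ ∈ Δ, ((z / p : ℕ) : ZMod p) = g * (z : ZMod p) ^ 2 - δ
  have hp0 : 0 < p := hp.pos
  have mem_B : ∀ (x : ZMod p), ∀ g ∈ S, ∀ δ ∈ Δ, x.val + p * (g * x ^ 2 - δ).val ∈ B := by
    intro x g hg δ hδ
    have hx := x.val_lt
    have hy := (g * x ^ 2 - δ).val_lt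
    refine Finset.mem_filter.2 ⟨Finset.mem_range.2 (by nlinarith), g, hg, δ, hδ, ?_⟩
    rw [Nat.add_mul_div_left _ _ hp0, Nat.div_eq_of_lt hx]
    simp
  refine ⟨B, Finset.filter_subset _ _, fun n => ⟨?_, ?_⟩⟩
  · obtain ⟨g, hg, h, hh, x, hx⟩ := hcover n ((n / p : ℤ) : ZMod p)
    have hX := x.val_lt
    have hX' := ((n : ZMod p) - x).val_lt
    obtain ⟨ε, hε, hsum⟩ : ∃ ε : ℤ, (ε = 0 ∨ ε = 1) ∧
        (x.val + ((n : ZMod p) - x).val : ℤ) = n % p + ε * p := by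
      have hd : (p : ℤ) ∣ x.val + ((n : ZMod p) - x).val - n % p := by
        rw [← ZMod.intCast_zmod_eq_zero_iff_dvd]
        simp
      obtain ⟨k, hk⟩ := hd
      have h0 := Int.emod_nonneg n (by omega : (p : ℤ) ≠ 0)
      have h1 := Int.emod_lt_of_pos n (by omega : (0 : ℤ) < p)
      have hk0 : 0 ≤ k := by
        by_contra! hlt
        nlinarith
      have hk1 : k ≤ 1 := by
        by_contra! hlt
        nlinarith
      exact ⟨k, by omega, by linear_combination hk⟩
    refine ⟨_, mem_B x g hg 0 (by simp [Δ]), _, mem_B (n - x) h hh (ε : ZMod p) ?_, ?_⟩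
    · rcases hε with rfl | rfl <;> simp [Δ]
    · push_cast
      have := (sq_dvd_sub_iff hX hX' ((g * x ^ 2 - 0).val : ℤ)
        ((h * ((n : ZMod p) - x) ^ 2 - ε).val : ℤ) n).2 ⟨ε, hε, hsum, ?_⟩
      · simpa using this
      · rw [← ZMod.intCast_zmod_eq_zero_iff_dvd]
        push_cast
        simp only [ZMod.natCast_zmod_val]
        linear_combination -hx
  · let E : Finset (ZMod p) := {-1, 0, 1, 2}
    let X : Finset (ZMod p) := (S ×ˢ S ×ˢ E).biUnion fun t =>
      Finset.univ.filter fun x => t.1 * x ^ 2 + t.2.1 * ((n : ZMod p) - x) ^ 2 =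
        ((n / p : ℤ) : ZMod p) + t.2.2
    let T : Finset ℕ := (X ×ˢ S ×ˢ Δ).image fun t => t.1.val + p * (t.2.1 * t.1 ^ 2 - t.2.2).val
    have hX : X.card ≤ 72 := by
      refine (Finset.card_biUnion_le_card_mul _ _ 2 ?_).trans ?_
      · rintro ⟨g, h, e⟩ ht
        simp only [Finset.mem_product] at ht
        exact card_quadratic_roots_le (hS g ht.1 h ht.2.1) _ _
      · rw [Finset.card_product, Finset.card_product]
        have : E.card ≤ 4 := Finset.card_le_four
        calc S.card * (S.card * E.card) * 2 ≤ 3 * (3 * 4) * 2 := by gcongr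
          _ = 72 := by norm_num
    have hT : T.card ≤ 432 := by
      refine Finset.card_image_le.trans ?_
      rw [Finset.card_product, Finset.card_product]
      have : Δ.card ≤ 2 := Finset.card_le_two
      calc X.card * (S.card * Δ.card) ≤ 72 * (3 * 2) := by gcongr
        _ = 432 := by norm_num
    refine (Finset.card_le_card_of_injOn Prod.fst ?_ ?_).trans hT
    · rintro ⟨z, w⟩ hzw
      simp only [Finset.coe_filter, Finset.mem_product, Set.mem_ofPred_eq, B, Finset.mem_filter,
        Finset.mem_range] at hzw
      obtain ⟨⟨⟨hz, g, hg, δ, hδ, hgz⟩, hw, h, hh, δ', hδ', hhw⟩, hd⟩ := hzw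
      have hz' : z / p < p := Nat.div_lt_of_lt_mul (by rwa [← sq])
      have hzp : ((z % p : ℕ) : ℤ) + p * ((z / p : ℕ) : ℤ) = z := by
        exact_mod_cast Nat.mod_add_div z p
      have hwp : ((w % p : ℕ) : ℤ) + p * ((w / p : ℕ) : ℤ) = w := by
        exact_mod_cast Nat.mod_add_div w p
      obtain ⟨ε, hε, -, hv⟩ := (sq_dvd_sub_iff (Nat.mod_lt z hp0) (Nat.mod_lt w hp0)
        ((z / p : ℕ) : ℤ) ((w / p : ℕ) : ℤ) n).1 (by rw [hzp, hwp]; exact hd)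
      have hwz : (w : ZMod p) = n - z := by
        have : (p : ℤ) ∣ n - z - w := (Dvd.intro _ (by push_cast; ring)).trans hd
        rw [← ZMod.intCast_zmod_eq_zero_iff_dvd] at this
        push_cast at this
        linear_combination -this
      rw [← ZMod.intCast_zmod_eq_zero_iff_dvd] at hv
      push_cast [-Int.natCast_ediv] at hv
      rw [hgz, hhw, hwz] at hv
      refine Finset.mem_coe.2 (Finset.mem_image.2 ⟨((z : ZMod p), g, δ), ?_, ?_⟩)
      · simp only [Finset.mem_product]
        refine ⟨Finset.mem_biUnion.2 ⟨(g, h, δ + δ' - ε), ?_, ?_⟩, hg, hδ⟩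
        · simp only [Finset.mem_product]
          refine ⟨hg, hh, ?_⟩
          simp only [Δ, Finset.mem_insert, Finset.mem_singleton] at hδ hδ'
          rcases hδ with rfl | rfl <;> rcases hδ' with rfl | rfl <;> rcases hε with rfl | rfl <;>
            norm_num [E]
        · simp only [Finset.mem_filter, Finset.mem_univ, true_and]
          linear_combination -hv
      · simp only
        rw [← hgz, ZMod.val_natCast, ZMod.val_natCast, Nat.mod_eq_of_lt hz']
        exact Nat.mod_add_div z p
    · rintro ⟨z, w⟩ hzw ⟨z', w'⟩ hzw' (rfl : z = z')
      simp only [Finset.coe_filter, Finset.mem_product, Set.mem_ofPred_eq, B, Finset.mem_filter,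
        Finset.mem_range] at hzw hzw'
      have hw := hzw.1.2.1
      have hw' := hzw'.1.2.1
      have hd := dvd_sub hzw.2 hzw'.2
      have : w = w' := by
        refine Nat.ModEq.eq_of_lt_of_lt ?_ hw hw'
        rw [Nat.modEq_iff_dvd]
        rwa [show (w' - w : ℤ) = n - z - w - (n - z - w') by ring]
      rw [this]

lemma IsThinBasisMod.prod {M m R r : ℕ} {D B : Finset ℕ} (hD : IsThinBasisMod M D R)
    (hB : IsThinBasisMod m B r) :
    IsThinBasisMod (M * m) ((Finset.range (M * m)).filter fun z => z % M ∈ D ∧ z / M ∈ B)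
      (R * r) := by
  classical
  refine ⟨Finset.filter_subset _ _, fun n => ⟨?_, ?_⟩⟩
  · obtain ⟨a, ha, b, hb, k, hk⟩ := (hD.2 n).1
    obtain ⟨c, hc, d, hd, l, hl⟩ := (hB.2 k).1
    have mem : ∀ a ∈ D, ∀ c ∈ B,
        a + M * c ∈ (Finset.range (M * m)).filter fun z => z % M ∈ D ∧ z / M ∈ B := by
      intro a ha c hc
      have haM := Finset.mem_range.1 (hD.1 ha)
      have hcm := Finset.mem_range.1 (hB.1 hc)
      refine Finset.mem_filter.2 ⟨Finset.mem_range.2 (by nlinarith), ?_, ?_⟩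
      · rwa [Nat.add_mul_mod_self_left, Nat.mod_eq_of_lt haM]
      · rwa [Nat.add_mul_div_left _ _ (by omega), Nat.div_eq_of_lt haM, zero_add]
    refine ⟨_, mem a ha c hc, _, mem b hb d hd, l, ?_⟩
    push_cast
    linear_combination hk + M * hl
  · rw [mul_comm R r]
    refine (Finset.card_le_mul_card_image_of_maps_to
      (t := (D ×ˢ D).filter fun q : ℕ × ℕ => (M : ℤ) ∣ n - q.1 - q.2)
      (f := fun q : ℕ × ℕ => (q.1 % M, q.2 % M)) ?_ r ?_).trans
      (Nat.mul_le_mul_left _ (hD.2 n).2)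
    · rintro ⟨z, w⟩ hq
      simp only [Finset.mem_filter, Finset.mem_product, Finset.mem_range] at hq ⊢
      obtain ⟨⟨hz, hw⟩, k, hk⟩ := hq
      refine ⟨⟨hz.2.1, hw.2.1⟩, m * k + z / M + w / M, ?_⟩
      push_cast at hk ⊢
      linear_combination hk - Int.emod_add_mul_ediv z M - Int.emod_add_mul_ediv w M
    · rintro ⟨a, b⟩ hab
      simp only [Finset.mem_filter, Finset.mem_product] at hab
      obtain ⟨⟨ha, hb⟩, k, hk⟩ := hab
      have hM : (M : ℤ) ≠ 0 := by
        have := Finset.mem_range.1 (hD.1 ha)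
        omega
      refine (Finset.card_le_card_of_injOn (fun q : ℕ × ℕ => (q.1 / M, q.2 / M)) ?_ ?_).trans
        (hB.2 k).2
      · rintro ⟨z, w⟩ hq
        simp only [Finset.coe_filter, Finset.mem_filter, Finset.mem_product, Finset.mem_range,
          Set.mem_ofPred_eq, Prod.mk.injEq] at hq ⊢
        obtain ⟨⟨⟨hz, hw⟩, l, hl⟩, rfl, rfl⟩ := hq
        refine ⟨⟨hz.2.2, hw.2.2⟩, l, mul_left_cancel₀ hM ?_⟩
        push_cast at hl hk ⊢
        linear_combination hl - hk - Int.emod_add_mul_ediv z M - Int.emod_add_mul_ediv w M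
      · rintro ⟨z, w⟩ hq ⟨z', w'⟩ hq' h
        simp only [Finset.coe_filter, Finset.mem_filter, Set.mem_ofPred_eq, Prod.mk.injEq]
          at hq hq' h
        rw [← Nat.mod_add_div z M, ← Nat.mod_add_div w M, hq.2.1, hq.2.2, h.1, h.2,
          ← hq'.2.1, ← hq'.2.2, Nat.mod_add_div, Nat.mod_add_div]

/-- The numbers with exactly `k` digits in the mixed radix system with radices `m 0, m 1, …`
whose `i`-th digit lies in `B i`. -/
def digitSet (m : ℕ → ℕ) (B : ℕ → Finset ℕ) : ℕ → Finset ℕ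
  | 0 => {0}
  | k + 1 => (Finset.range ((∏ i ∈ Finset.range k, m i) * m k)).filter fun z =>
      z % (∏ i ∈ Finset.range k, m i) ∈ digitSet m B k ∧ z / (∏ i ∈ Finset.range k, m i) ∈ B k

/-- The numbers whose low digits are restricted to the sets `B i` and whose remaining top part,
above position `k`, is unrestricted but less than `4 * m k`. -/
def digitBasis (m : ℕ → ℕ) (B : ℕ → Finset ℕ) : Set ℕ :=
  {z | ∃ k, z % (∏ i ∈ Finset.range k, m i) ∈ digitSet m B k ∧
    z < (∏ i ∈ Finset.range k, m i) * (4 * m k)}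

section digits

variable {m : ℕ → ℕ} {B : ℕ → Finset ℕ} {R : ℕ}

lemma isThinBasisMod_digitSet (hB : ∀ k, IsThinBasisMod (m k) (B k) R) (k : ℕ) :
    IsThinBasisMod (∏ i ∈ Finset.range k, m i) (digitSet m B k) (R ^ k) := by
  induction k with
  | zero =>
    refine ⟨by simp [digitSet], fun n => ⟨by simp [digitSet], ?_⟩⟩
    exact (Finset.card_filter_le _ _).trans (by simp [digitSet])
  | succ k ih =>
    rw [Finset.prod_range_succ, pow_succ]
    exact ih.prod (hB k)

lemma mod_mem_digitSet {l j z : ℕ} (hlj : l ≤ j)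
    (hz : z % (∏ i ∈ Finset.range j, m i) ∈ digitSet m B j) :
    z % (∏ i ∈ Finset.range l, m i) ∈ digitSet m B l := by
  induction j, hlj using Nat.le_induction with
  | base => exact hz
  | succ j hj ih =>
    apply ih
    have := (Finset.mem_filter.1 hz).2.1
    rwa [Nat.mod_mod_of_dvd _ (Finset.prod_range_succ m j ▸ Dvd.intro _ rfl)] at this

lemma exists_add_eq_of_digitBasis (hB : ∀ k, IsThinBasisMod (m k) (B k) R)
    (hm : ∀ n, ∃ k, n < ∏ i ∈ Finset.range k, m i) (n : ℕ) :
    ∃ a ∈ digitBasis m B, ∃ b ∈ digitBasis m B, a + b = n := by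
  classical
  have hex : ∃ k, n + 2 < 2 * ∏ i ∈ Finset.range k, m i := by
    obtain ⟨k, hk⟩ := hm (n + 2)
    exact ⟨k, by omega⟩
  obtain ⟨k, hk⟩ : ∃ k, Nat.find hex = k + 1 := by
    refine Nat.exists_eq_succ_of_ne_zero fun h0 => ?_
    have := Nat.find_spec hex
    simp [h0] at this
  have hlt := Nat.find_spec hex
  have hle := Nat.find_min hex (m := k) (by omega)
  rw [hk, Finset.prod_range_succ] at hlt
  have hthin := isThinBasisMod_digitSet hB k
  unfold digitBasis
  obtain ⟨a, ha, b, hb, t, ht⟩ := (hthin.2 n).1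
  have haM := Finset.mem_range.1 (hthin.1 ha)
  have hbM := Finset.mem_range.1 (hthin.1 hb)
  have ha' := Nat.mod_eq_of_lt haM
  have hb' := Nat.mod_eq_of_lt hbM
  set M := ∏ i ∈ Finset.range k, m i with hMdef
  have ht0 : 0 ≤ t := by
    by_contra! hneg
    have : (M : ℤ) * t < 0 := mul_neg_of_pos_of_neg (by omega) hneg
    omega
  lift t to ℕ using ht0
  have hsum : a + M * t + b = n := by
    zify
    linear_combination -ht
  refine ⟨a + M * t, ⟨k, ?_, ?_⟩, b, ⟨k, ?_, ?_⟩, hsum⟩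
  · rwa [← hMdef, Nat.add_mul_mod_self_left, ha']
  · rw [← hMdef]
    nlinarith
  · rwa [← hMdef, hb']
  · rw [← hMdef]
    nlinarith

lemma ncard_digitBasis_le (hB : ∀ k, IsThinBasisMod (m k) (B k) R) {n K : ℕ}
    (hn : n < ∏ i ∈ Finset.range K, m i) :
    {q : ℕ × ℕ | q.1 ∈ digitBasis m B ∧ q.2 ∈ digitBasis m B ∧ q.1 + q.2 = n}.ncard ≤
      ∑ l ∈ Finset.range (K + 1), 8 * m l * R ^ l := by
  classical
  have hpos : ∀ k, 0 < m k := fun k => by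
    obtain ⟨a, ha, -⟩ := ((hB k).2 0).1
    exact (Nat.zero_le a).trans_lt (Finset.mem_range.1 ((hB k).1 ha))
  let M : ℕ → ℕ := fun l => ∏ i ∈ Finset.range l, m i
  have hM : ∀ l, 0 < M l := fun l => Finset.prod_pos fun i _ => hpos i
  let D := digitSet m B
  let G : ℕ → Finset (ℕ × ℕ) := fun l =>
    (D l ×ˢ D l).filter fun q : ℕ × ℕ => (M l : ℤ) ∣ (n : ℤ) - q.1 - q.2
  let P : ℕ → (ℕ × ℕ → ℕ) → Finset (ℕ × ℕ) := fun l f =>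
    (Finset.HasAntidiagonal.antidiagonal n).filter fun q =>
      (q.1 % M l ∈ D l ∧ q.2 % M l ∈ D l) ∧ f q < M l * (4 * m l)
  have hP : ∀ l f, (f = Prod.fst ∨ f = Prod.snd) → (P l f).card ≤ 4 * m l * R ^ l := by
    intro l f hf
    have : (P l f).card ≤ (Finset.range (4 * m l) ×ˢ G l).card := by
      refine Finset.card_le_card_of_injOn (fun q => (f q / M l, (q.1 % M l, q.2 % M l))) ?_ ?_
      · rintro ⟨a, b⟩ hq
        simp only [P, G, Finset.coe_filter, Finset.HasAntidiagonal.mem_antidiagonal, Set.mem_ofPred_eq,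
          Finset.coe_product, Set.mem_prod, Finset.mem_coe, Finset.mem_range,
          Finset.mem_product] at hq ⊢
        obtain ⟨rfl, hq, hlt⟩ := hq
        refine ⟨Nat.div_lt_of_lt_mul hlt, hq, a / M l + b / M l, ?_⟩
        push_cast
        linear_combination -Int.emod_add_mul_ediv a (M l) - Int.emod_add_mul_ediv b (M l)
      · rintro ⟨a, b⟩ hq ⟨a', b'⟩ hq' h
        simp only [P, Finset.coe_filter, Finset.HasAntidiagonal.mem_antidiagonal, Set.mem_ofPred_eq,
          Prod.mk.injEq] at hq hq' h
        have ea := Nat.mod_add_div a (M l)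
        have ea' := Nat.mod_add_div a' (M l)
        have eb := Nat.mod_add_div b (M l)
        have eb' := Nat.mod_add_div b' (M l)
        rw [Prod.mk.injEq]
        rcases hf with rfl | rfl
        · simp only at h
          rw [h.1, h.2.1] at ea
          omega
        · simp only at h
          rw [h.1, h.2.2] at eb
          omega
    rw [Finset.card_product, Finset.card_range] at this
    exact this.trans (Nat.mul_le_mul_left _ ((isThinBasisMod_digitSet hB l).2 n).2)
  have hsub : {q : ℕ × ℕ | q.1 ∈ digitBasis m B ∧ q.2 ∈ digitBasis m B ∧ q.1 + q.2 = n} ⊆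
      ((Finset.range (K + 1)).biUnion fun l => P l Prod.fst ∪ P l Prod.snd : Finset (ℕ × ℕ)) := by
    have key : ∀ a ∈ digitBasis m B, a ≤ n →
        ∃ k ≤ K, a % M k ∈ D k ∧ a < M k * (4 * m k) := by
      rintro a ⟨k, hk, hlt⟩ han
      rcases le_total k K with h | h
      · exact ⟨k, h, hk, hlt⟩
      · refine ⟨K, le_rfl, mod_mem_digitSet h hk, ?_⟩
        have haM : a < M K := han.trans_lt hn
        nlinarith [hpos K]
    rintro ⟨a, b⟩ ⟨ha, hb, rfl⟩
    obtain ⟨i, hi, hai, hai'⟩ := key a ha (Nat.le_add_right _ _)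
    obtain ⟨j, hj, hbj, hbj'⟩ := key b hb (Nat.le_add_left _ _)
    simp only [Finset.coe_biUnion, Set.mem_iUnion, Finset.mem_coe, Finset.mem_union,
      Finset.mem_range, P, Finset.mem_filter, Finset.HasAntidiagonal.mem_antidiagonal, exists_prop, true_and]
    rcases le_total i j with h | h
    · exact ⟨i, by omega, Or.inl ⟨⟨hai, mod_mem_digitSet h hbj⟩, hai'⟩⟩
    · exact ⟨j, by omega, Or.inr ⟨⟨mod_mem_digitSet h hai, hbj⟩, hbj'⟩⟩
  refine (Set.ncard_le_ncard hsub (Finset.finite_toSet _)).trans ?_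
  rw [Set.ncard_coe_finset]
  refine Finset.card_biUnion_le.trans (Finset.sum_le_sum fun l _ => ?_)
  calc (P l Prod.fst ∪ P l Prod.snd).card ≤ (P l Prod.fst).card + (P l Prod.snd).card :=
        Finset.card_union_le _ _
    _ ≤ 4 * m l * R ^ l + 4 * m l * R ^ l :=
        add_le_add (hP l _ (Or.inl rfl)) (hP l _ (Or.inr rfl))
    _ = 8 * m l * R ^ l := by ring

end digits

lemma exists_modulus (k : ℕ) :
    ∃ m B, IsThinBasisMod m B 432 ∧ 4 ^ (2 * k + 1) ≤ m ∧ m ≤ 256 * 16 ^ k := by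
  obtain ⟨p, hp, hlt, hle⟩ := Nat.exists_prime_lt_and_le_two_mul (8 * 4 ^ k) (by positivity)
  have h1 : 1 ≤ 4 ^ k := Nat.one_le_pow _ _ (by norm_num)
  obtain ⟨B, hB⟩ := exists_isThinBasisMod_sq hp (by omega)
  have h4 : 4 ^ (2 * k + 1) = (4 ^ k) ^ 2 * 4 := by ring
  have h16 : 16 ^ k = (4 ^ k) ^ 2 := by
    rw [← pow_mul, mul_comm k 2, pow_mul]
    norm_num
  refine ⟨p ^ 2, B, hB, ?_, ?_⟩
  · rw [h4]
    nlinarith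
  · rw [h16]
    nlinarith

lemma four_pow_sq_le_prod {m : ℕ → ℕ} (hm : ∀ k, 4 ^ (2 * k + 1) ≤ m k) (k : ℕ) :
    4 ^ (k ^ 2) ≤ ∏ i ∈ Finset.range k, m i := by
  induction k with
  | zero => simp
  | succ k ih =>
    rw [Finset.prod_range_succ, show (k + 1) ^ 2 = k ^ 2 + (2 * k + 1) by ring, pow_add]
    exact Nat.mul_le_mul ih (hm k)

lemma sum_mul_pow_le {m : ℕ → ℕ} (hm : ∀ k, m k ≤ 256 * 16 ^ k) (K : ℕ) :
    ∑ l ∈ Finset.range (K + 1), 8 * m l * 432 ^ l ≤ 2048 * 13824 ^ K := by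
  calc ∑ l ∈ Finset.range (K + 1), 8 * m l * 432 ^ l
      ≤ ∑ l ∈ Finset.range (K + 1), 2048 * 6912 ^ K := by
        refine Finset.sum_le_sum fun l hl => ?_
        have hlK : l ≤ K := Nat.lt_succ_iff.1 (Finset.mem_range.1 hl)
        calc 8 * m l * 432 ^ l ≤ 8 * (256 * 16 ^ l) * 432 ^ l := by gcongr; exact hm l
          _ = 2048 * 6912 ^ l := by
            rw [show 6912 = 16 * 432 by norm_num, mul_pow]
            ring
          _ ≤ 2048 * 6912 ^ K := by gcongr; norm_num
    _ = 2048 * ((K + 1) * 6912 ^ K) := by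
        rw [Finset.sum_const, Finset.card_range, smul_eq_mul]
        ring
    _ ≤ 2048 * (2 ^ K * 6912 ^ K) := by
        gcongr
        exact Nat.lt_two_pow_self
    _ = 2048 * 13824 ^ K := by rw [← mul_pow]; norm_num

lemma pow_le_rpow_div_log_log {Q : ℝ} (hQ : 1 ≤ Q) {j n : ℕ} (hn : 16 ≤ n)
    (hj : 4 ^ (j ^ 2) ≤ n) :
    Q ^ j ≤ (n : ℝ) ^ (2 * Real.log Q / Real.log (Real.log n)) := by
  have hn0 : (0 : ℝ) < n := by
    have : 0 < n := by omega
    exact_mod_cast this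
  have he : Real.exp 1 < 4 := Real.exp_one_lt_d9.trans (by norm_num)
  have hlog4 : 1 < Real.log 4 := (Real.lt_log_iff_exp_lt (by norm_num)).2 he
  have hL : 1 < Real.log n :=
    hlog4.trans_le (Real.log_le_log (by norm_num) (by exact_mod_cast (by omega : 4 ≤ n)))
  have hLL : 0 < Real.log (Real.log n) := Real.log_pos hL
  have hj2 : (j : ℝ) ^ 2 ≤ Real.log n := by
    have h1 : Real.log ((4 : ℝ) ^ (j ^ 2)) ≤ Real.log n :=
      Real.log_le_log (by positivity) (by exact_mod_cast hj)
    rw [Real.log_pow] at h1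
    push_cast at h1
    nlinarith [sq_nonneg (j : ℝ)]
  set L := Real.log n with hLdef
  have hL0 : 0 < L := by linarith
  have hsq : Real.sqrt L * Real.sqrt L = L := Real.mul_self_sqrt hL0.le
  have hjs : (j : ℝ) ≤ Real.sqrt L := Real.le_sqrt_of_sq_le hj2
  have hlogL : Real.log L ≤ 2 * Real.sqrt L := by
    have h1 := Real.log_le_sub_one_of_pos (Real.sqrt_pos.2 hL0)
    rw [Real.log_sqrt hL0.le] at h1
    linarith
  have hmain : j * Real.log L ≤ 2 * L := by
    calc j * Real.log L ≤ Real.sqrt L * (2 * Real.sqrt L) := by gcongr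
      _ = 2 * L := by linear_combination 2 * hsq
  have hlogQ := Real.log_nonneg hQ
  rw [Real.rpow_def_of_pos hn0, ← hLdef, ← Real.exp_log (show 0 < Q by linarith),
    ← Real.exp_nat_mul, Real.exp_le_exp, Real.log_exp, ← mul_div_assoc, le_div_iff₀ hLL]
  nlinarith

theorem stmt11 :
    ∃ A : Set ℕ, ∃ C c : ℝ, 0 < C ∧ 0 < c ∧ ∀ n : ℕ,
      (1 ≤ ({q : ℕ × ℕ | q.1 ∈ A ∧ q.2 ∈ A ∧ q.1 + q.2 = n}).ncard) ∧
      (16 ≤ n →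
        (({q : ℕ × ℕ | q.1 ∈ A ∧ q.2 ∈ A ∧ q.1 + q.2 = n}).ncard : ℝ) ≤
          C * (n : ℝ) ^ (c / Real.log (Real.log n))) ∧
      (n ≤ 15 →
        (({q : ℕ × ℕ | q.1 ∈ A ∧ q.2 ∈ A ∧ q.1 + q.2 = n}).ncard : ℝ) ≤ C) := by
  classical
  choose m B hB hm hm' using exists_modulus
  have hM := four_pow_sq_le_prod hm
  have hunb : ∀ n, ∃ k, n < ∏ i ∈ Finset.range k, m i := fun n =>
    ⟨n, calc n < 4 ^ n := Nat.lt_pow_self (by norm_num)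
      _ ≤ 4 ^ (n ^ 2) := Nat.pow_le_pow_right (by norm_num) (Nat.le_self_pow two_ne_zero n)
      _ ≤ _ := hM n⟩
  have hcard : ∀ n K, n < ∏ i ∈ Finset.range K, m i →
      ({q : ℕ × ℕ | q.1 ∈ digitBasis m B ∧ q.2 ∈ digitBasis m B ∧ q.1 + q.2 = n}.ncard : ℝ) ≤
        2048 * 13824 ^ K := fun n K hn => by
    exact_mod_cast (ncard_digitBasis_le hB hn).trans (sum_mul_pow_le hm' K)
  refine ⟨digitBasis m B, 2048 * 13824 ^ 2, 2 * Real.log 13824, by norm_num,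
    mul_pos two_pos (Real.log_pos (by norm_num)), fun n => ⟨?_, fun hn => ?_, fun hn => ?_⟩⟩
  · obtain ⟨a, ha, b, hb, hab⟩ := exists_add_eq_of_digitBasis hB hunb n
    refine Nat.one_le_iff_ne_zero.2 (Set.ncard_ne_zero_of_mem (a := (a, b)) ⟨ha, hb, hab⟩ ?_)
    refine (Finset.HasAntidiagonal.antidiagonal n).finite_toSet.subset fun q hq => ?_
    exact Finset.mem_coe.2 (Finset.HasAntidiagonal.mem_antidiagonal.2 hq.2.2)
  · obtain ⟨j, hj⟩ : ∃ j, Nat.find (hunb n) = j + 1 := by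
      refine Nat.exists_eq_succ_of_ne_zero fun h0 => ?_
      have := Nat.find_spec (hunb n)
      rw [h0, Finset.prod_range_zero] at this
      omega
    have hlt := Nat.find_spec (hunb n)
    have hle := not_lt.1 (Nat.find_min (hunb n) (m := j) (by omega))
    rw [hj] at hlt
    calc _ ≤ (2048 * 13824 ^ (j + 1) : ℝ) := hcard n _ hlt
      _ = 2048 * 13824 * 13824 ^ j := by ring
      _ ≤ 2048 * 13824 ^ 2 * 13824 ^ j := by gcongr; norm_num
      _ ≤ _ := by
        gcongr
        exact pow_le_rpow_div_log_log (by norm_num) hn ((hM j).trans hle)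
  · exact hcard n 2 (lt_of_lt_of_le (by norm_num; omega) (hM 2))
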